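/- arXiv:cs/0607060 — 6 statements merged into one kernel-verified Lean document; each statement's English description precedes it below -/
import Mathlib

section
/- Let S be a set of at least 9 points of the plane ℝ². Suppose c, c' ∈ ℝ², r₁ > r₂ > 0 and r₁' > r₂' > 0 are such that every point of S lies on sphere(c, r₁) ∪ sphere(c, r₂) and also on sphere(c', r₁') ∪ sphere(c', r₂'), and each of the four circles sphere(c, r₁), sphere(c, r₂), sphere(c', r₁'), sphere(c', r₂') contains at least one point of S. Then c = c', r₁ = r₁' and r₂ = r₂'; i.e., the pair of concentric circles on which the points lie is unique. -/
open Metric in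
/-- Two circles of the plane with different centers meet in at most two points. -/
theorem encard_sphere_inter_sphere_le_two {c c' : EuclideanSpace ℝ (Fin 2)} (h : c ≠ c')
    (r r' : ℝ) : (sphere c r ∩ sphere c' r').encard ≤ 2 := by
  by_contra! hlt
  obtain ⟨t, hts, ht⟩ := Set.exists_subset_encard_eq (k := 3) (Order.add_one_le_of_lt hlt)
  obtain ⟨x, y, z, hxy, hxz, hyz, rfl⟩ := Set.encard_eq_three.1 ht
  obtain ⟨hx, hx'⟩ := hts (by simp : x ∈ ({x, y, z} : Set _))
  obtain ⟨hy, hy'⟩ := hts (by simp : y ∈ ({x, y, z} : Set _))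
  obtain ⟨hz, hz'⟩ := hts (by simp : z ∈ ({x, y, z} : Set _))
  rcases EuclideanGeometry.eq_of_dist_eq_of_dist_eq_of_finrank_eq_two (by simp) h hxy
    hx hy hz hx' hy' hz' with hzx | hzy
  · exact hxz hzx.symm
  · exact hyz hzy.symm

/-- If a set `S` of at least `9` points of the plane lies on a pair of concentric
circles (center `c`, radii `r₁ > r₂ > 0`, at least one point of `S` on each circle)
and also on another such pair (center `c'`, radii `r₁' > r₂' > 0`, at least one point
of `S` on each circle), then the two pairs coincide: `c = c'`, `r₁ = r₁'`, `r₂ = r₂'`. -/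
theorem concentric_pair_unique (S : Set (EuclideanSpace ℝ (Fin 2))) (hS : 9 ≤ S.encard)
    (c c' : EuclideanSpace ℝ (Fin 2)) (r₁ r₂ r₁' r₂' : ℝ)
    (hr₂ : 0 < r₂) (hr₁₂ : r₂ < r₁) (hr₂' : 0 < r₂') (hr₁₂' : r₂' < r₁')
    (hsub : S ⊆ Metric.sphere c r₁ ∪ Metric.sphere c r₂)
    (hsub' : S ⊆ Metric.sphere c' r₁' ∪ Metric.sphere c' r₂')
    (hne₁ : (S ∩ Metric.sphere c r₁).Nonempty)
    (hne₂ : (S ∩ Metric.sphere c r₂).Nonempty)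
    (hne₁' : (S ∩ Metric.sphere c' r₁').Nonempty)
    (hne₂' : (S ∩ Metric.sphere c' r₂').Nonempty) :
    c = c' ∧ r₁ = r₁' ∧ r₂ = r₂' := by
  rcases eq_or_ne c c' with rfl | hc
  · obtain ⟨x, hxS, hx⟩ := hne₁
    obtain ⟨y, hyS, hy⟩ := hne₂
    obtain ⟨z, hzS, hz⟩ := hne₁'
    obtain ⟨w, hwS, hw⟩ := hne₂'
    have hx' := hsub' hxS
    have hy' := hsub' hyS
    have hz' := hsub hzS
    have hw' := hsub hwS
    simp only [Set.mem_union, Metric.mem_sphere] at hx hy hz hw hx' hy' hz' hw'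
    refine ⟨rfl, ?_, ?_⟩ <;> grind
  · have hcover : S ⊆
        (Metric.sphere c r₁ ∩ Metric.sphere c' r₁' ∪ Metric.sphere c r₁ ∩ Metric.sphere c' r₂') ∪
        (Metric.sphere c r₂ ∩ Metric.sphere c' r₁' ∪ Metric.sphere c r₂ ∩ Metric.sphere c' r₂') := by
      rw [← Set.inter_union_distrib_left, ← Set.inter_union_distrib_left,
        ← Set.union_inter_distrib_right]
      exact Set.subset_inter hsub hsub'
    have h (r r' : ℝ) := encard_sphere_inter_sphere_le_two hc r r'
    have hle : S.encard ≤ (2 + 2) + (2 + 2) :=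
      (Set.encard_le_encard hcover).trans <| (Set.encard_union_le _ _).trans <|
        add_le_add ((Set.encard_union_le _ _).trans (add_le_add (h _ _) (h _ _)))
          ((Set.encard_union_le _ _).trans (add_le_add (h _ _) (h _ _)))
    exact absurd (hS.trans hle) (by norm_num)
end

section
/- Let n = 2p with p ≥ 1 points form a strict biangular circle with 0 < α < β (gaps alternating α at even indices, β at odd indices, so α + β = 4π/n and α < 2π/n < β). Set δ = π/n − α/2 and define target angles θ' i = θ i − δ for even i and θ' i = θ i + δ for odd i. Then θ' (i+1) − θ' i = 2π/n for all 0 ≤ i ≤ n−2 and θ' 0 + 2π − θ' (n−1) = 2π/n; equivalently θ' i = θ' 0 + i·(2π/n) for all i. Consequently, if all robots are activated simultaneously, the destination points q i = c + 2r·(cos(θ' i), sin(θ' i)) form a regular n-gon inscribed in the concentric circle of center c and radius 2r. -/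
open Real

/-- The consecutive central gaps of angles `θ 0 < θ 1 < ⋯ < θ (n-1) < θ 0 + 2π`. -/
noncomputable def gap (n : ℕ) (θ : Fin n → ℝ) (i : Fin n) : ℝ :=
  if h : (i : ℕ) + 1 < n then θ ⟨(i : ℕ) + 1, h⟩ - θ i
  else θ ⟨0, i.pos⟩ + 2 * π - θ i

/-- Closed form of the angles when the central gaps alternate between `α` and `β`. -/
theorem angle_eq_of_alternating_gap {n : ℕ} (hn : 0 < n) {θ : Fin n → ℝ} {α β : ℝ}
    (hgap : ∀ i : Fin n, gap n θ i = if (i : ℕ) % 2 = 0 then α else β) (m : ℕ) (hm : m < n) :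
    θ ⟨m, hm⟩ = θ ⟨0, hn⟩ + m * ((α + β) / 2) + if m % 2 = 0 then 0 else (α - β) / 2 := by
  induction m with
  | zero => simp
  | succ m ih =>
    have ih := ih (by omega)
    have hg := hgap ⟨m, by omega⟩
    simp only [gap, hm, dite_true] at hg
    push_cast
    rcases Nat.mod_two_eq_zero_or_one m with h | h
    · have h' : (m + 1) % 2 = 1 := by omega
      simp only [h, h', one_ne_zero, if_true, if_false] at hg ih ⊢
      linarith
    · have h' : (m + 1) % 2 = 0 := by omega
      simp only [h, h', one_ne_zero, if_true, if_false] at hg ih ⊢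
      linarith

/-- Angles in arithmetic progression with common difference `2π/n` have all central gaps
equal to `2π/n`. -/
theorem gap_eq_of_angle_eq {n : ℕ} (hn : 0 < n) {θ : Fin n → ℝ}
    (h : ∀ i : Fin n, θ i = θ ⟨0, hn⟩ + ((i : ℕ) : ℝ) * (2 * π / n)) (i : Fin n) :
    gap n θ i = 2 * π / n := by
  unfold gap
  split_ifs with hi
  · rw [h ⟨i + 1, hi⟩, h i]
    push_cast
    ring
  · have hin : ((i : ℕ) : ℝ) + 1 = n := by
      have := i.isLt
      exact_mod_cast (by omega : (i : ℕ) + 1 = n)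
    have hn' : (n : ℝ) * (2 * π / n) = 2 * π := by
      field_simp
    rw [h i]
    linear_combination (-(2 * π / n)) * hin - hn'

/-- Procedure BQ, synchronous case: for a strict biangular circle of `n = 2p` points
with `0 < α < β`, the target angles `θ' i = θ i - δ` (even `i`), `θ' i = θ i + δ`
(odd `i`), where `δ = π/n - α/2`, satisfy `θ' i = θ' 0 + i·(2π/n)`, and all their
consecutive central gaps equal `2π/n`; hence if all robots are activated
simultaneously, the destinations `q i = c + 2r·(cos(θ' i), sin(θ' i))` form a regular
`n`-gon inscribed in the concentric circle of center `c` and radius `2r`. -/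
theorem BQ_synchronous_regular_ngon (n p : ℕ) (hp : 1 ≤ p) (hnp : n = 2 * p)
    (θ : Fin n → ℝ) (hmono : StrictMono θ)
    (α β : ℝ) (hα : 0 < α) (hαβ : α < β)
    (hgap : ∀ i : Fin n, gap n θ i = if (i : ℕ) % 2 = 0 then α else β)
    (δ : ℝ) (hδ : δ = π / n - α / 2)
    (θ' : Fin n → ℝ)
    (hθ' : ∀ i : Fin n, θ' i = if (i : ℕ) % 2 = 0 then θ i - δ else θ i + δ) :
    (∀ i : Fin n, θ' i = θ' ⟨0, by omega⟩ + ((i : ℕ) : ℝ) * (2 * π / n)) ∧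
    (∀ i : Fin n, gap n θ' i = 2 * π / n) := by
  have hn : 0 < n := by omega
  have hθ := angle_eq_of_alternating_gap hn hgap
  have hstep : 2 * π / n = (α + β) / 2 := by
    have hlast := hgap ⟨n - 1, by omega⟩
    have hnot : ¬ (n - 1 + 1 < n) := by omega
    have hodd : (n - 1) % 2 = 1 := by omega
    simp only [gap, hnot, dite_false, hθ (n - 1), hodd, one_ne_zero, if_false] at hlast
    rw [Nat.cast_sub hn, Nat.cast_one] at hlast
    rw [div_eq_iff (by positivity)]
    linarith
  have hδ' : δ = (β - α) / 4 := by
    have : π / n = (2 * π / n) / 2 := by ring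
    rw [hδ, this, hstep]
    ring
  have hprog : ∀ i : Fin n, θ' i = θ' ⟨0, hn⟩ + ((i : ℕ) : ℝ) * (2 * π / n) := by
    intro i
    rw [hθ' i, hθ' ⟨0, hn⟩, hstep, hδ', hθ i i.isLt]
    rcases Nat.mod_two_eq_zero_or_one (i : ℕ) with h | h <;> simp [h] <;> ring
  exact ⟨hprog, gap_eq_of_angle_eq hn hprog⟩
end

section
/- Let n ≥ 9 with n = 2p points form a strict biangular circle with 0 < α < β, and let δ = π/n − α/2 and θ' i = θ i − δ for even i, θ' i = θ i + δ for odd i be the Procedure BQ target angles. Then for all indices i, j ∈ Fin n, θ' i is not congruent to θ j modulo 2π. Consequently, after any subset of robots moves to its target on the outer circle of radius 2r while the others stay on the inner circle of radius r, no robot on the outer circle lies on the same radius (half-line from c) as a robot on the inner circle, so the configuration is sliced into sectors by the radii through the outer robots. -/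
open Real

/-- A real number strictly between `0` and `S` is not an integer multiple of `S`. -/
theorem ne_intCast_mul_of_pos_of_lt {x S : ℝ} (hx : 0 < x) (hxS : x < S) (z : ℤ) :
    x ≠ z * S := by
  intro h
  have hS : 0 < S := hx.trans hxS
  have h0 : (0 : ℝ) < z := by
    by_contra! hz
    nlinarith
  have h1 : (z : ℝ) < 1 := by
    by_contra! hz
    nlinarith
  have h0' : 0 < z := by exact_mod_cast h0
  have h1' : z < 1 := by exact_mod_cast h1
  omega

/-- The angles of a biangular configuration, in terms of the first angle. -/
theorem biangular_angle_eq {n : ℕ} {θ : Fin n → ℝ} {α β : ℝ}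
    (hgap : ∀ i : Fin n, gap n θ i = if (i : ℕ) % 2 = 0 then α else β) (h0 : 0 < n) (m : ℕ)
    (hm : m < n) :
    θ ⟨m, hm⟩ = θ ⟨0, h0⟩ + (m / 2 : ℕ) * (α + β) + if m % 2 = 0 then 0 else α := by
  induction m with
  | zero => simp
  | succ m ih =>
    have hg := hgap ⟨m, by omega⟩
    have ih := ih (by omega)
    simp only [gap, hm, dite_true] at hg
    rcases Nat.mod_two_eq_zero_or_one m with h | h
    · have h1 : (m + 1) % 2 = 1 := by omega
      have h2 : (m + 1) / 2 = m / 2 := by omega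
      simp only [h, h1, h2, if_true, one_ne_zero, if_false] at hg ih ⊢
      linarith
    · have h1 : (m + 1) % 2 = 0 := by omega
      have h2 : (m + 1) / 2 = m / 2 + 1 := by omega
      simp only [h, h1, h2, if_true, one_ne_zero, if_false] at hg ih ⊢
      push_cast
      linarith

/-- The two gaps of a biangular configuration of `2 * p` points satisfy `p * (α + β) = 2 * π`. -/
theorem biangular_mul_add_eq {n p : ℕ} {θ : Fin n → ℝ} {α β : ℝ}
    (hgap : ∀ i : Fin n, gap n θ i = if (i : ℕ) % 2 = 0 then α else β) (h0 : 0 < n)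
    (hnp : n = 2 * p) : (p : ℝ) * (α + β) = 2 * π := by
  have hlast := hgap ⟨n - 1, by omega⟩
  have hangle := biangular_angle_eq hgap h0 (n - 1) (by omega)
  have hlt : ¬ n - 1 + 1 < n := by omega
  have hmod : (n - 1) % 2 = 1 := by omega
  have hp : (n - 1) / 2 + 1 = p := by omega
  simp only [gap, hlt, dite_false, hmod, one_ne_zero, if_false] at hlast hangle
  rw [← hp]
  push_cast
  linarith

/-- Procedure BQ slices the configuration into sectors: for a strict biangular circle
of `n = 2p ≥ 9` points with `0 < α < β` and target angles `θ' i = θ i ∓ δ`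
(`δ = π/n - α/2`, minus for even `i`, plus for odd `i`), no target angle `θ' i` is
congruent modulo `2π` to any current angle `θ j`; hence after any subset of robots
moves to the outer circle of radius `2r`, no outer robot lies on the same radius
(half-line from the center) as an inner robot. -/
theorem BQ_no_shared_radius (n p : ℕ) (hn : 9 ≤ n) (hnp : n = 2 * p)
    (θ : Fin n → ℝ) (hmono : StrictMono θ)
    (α β : ℝ) (hα : 0 < α) (hαβ : α < β)
    (hgap : ∀ i : Fin n, gap n θ i = if (i : ℕ) % 2 = 0 then α else β)
    (δ : ℝ) (hδ : δ = π / n - α / 2)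
    (θ' : Fin n → ℝ)
    (hθ' : ∀ i : Fin n, θ' i = if (i : ℕ) % 2 = 0 then θ i - δ else θ i + δ) :
    ∀ i j : Fin n, ∀ k : ℤ, θ' i ≠ θ j + 2 * π * (k : ℝ) := by
  have h0 : 0 < n := by omega
  have hp := biangular_mul_add_eq hgap h0 hnp
  have hδ' : δ = (β - α) / 4 := by
    have hp0 : (p : ℝ) ≠ 0 := by
      have : p ≠ 0 := by omega
      exact_mod_cast this
    have hn' : (n : ℝ) = 2 * p := by exact_mod_cast hnp
    have hπ : π = p * (α + β) / 2 := by linarith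
    rw [hδ, hn', hπ]
    field_simp
    ring
  have hδ_ne (z : ℤ) : δ ≠ z * (α + β) :=
    ne_intCast_mul_of_pos_of_lt (by linarith) (by linarith) z
  have hαδ_ne (z : ℤ) : α + δ ≠ z * (α + β) :=
    ne_intCast_mul_of_pos_of_lt (by linarith) (by linarith) z
  rintro ⟨i, hi⟩ ⟨j, hj⟩ k h
  rw [hθ', biangular_angle_eq hgap h0 i hi, biangular_angle_eq hgap h0 j hj, ← hp] at h
  rcases Nat.mod_two_eq_zero_or_one i with h1 | h1 <;>
    rcases Nat.mod_two_eq_zero_or_one j with h2 | h2 <;>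
    simp only [h1, h2, if_true, one_ne_zero, if_false] at h
  · apply hδ_ne (((i / 2 : ℕ) : ℤ) - ((j / 2 : ℕ) : ℤ) - p * k)
    simp only [Int.cast_sub, Int.cast_mul, Int.cast_natCast]
    linarith
  · apply hαδ_ne (((i / 2 : ℕ) : ℤ) - ((j / 2 : ℕ) : ℤ) - p * k)
    simp only [Int.cast_sub, Int.cast_mul, Int.cast_natCast]
    linarith
  · apply hαδ_ne (((j / 2 : ℕ) : ℤ) + p * k - ((i / 2 : ℕ) : ℤ))
    simp only [Int.cast_sub, Int.cast_add, Int.cast_mul, Int.cast_natCast]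
    linarith
  · apply hδ_ne (((j / 2 : ℕ) : ℤ) + p * k - ((i / 2 : ℕ) : ℤ))
    simp only [Int.cast_sub, Int.cast_add, Int.cast_mul, Int.cast_natCast]
    linarith
end

section
/- Let n = 2p with p ≥ 1 points form a strict biangular circle with 0 < α < β, and let δ = π/n − α/2 and θ' i = θ i − δ for even i, θ' i = θ i + δ for odd i be the Procedure BQ target angles. Then δ ∈ (0, π/n), for every i the angular distance |θ' i − θ i| equals δ, and the open angular intervals traversed by the robots, namely (θ i − δ, θ i) for even i and (θ i, θ i + δ) for odd i, are pairwise disjoint; i.e., the trajectories of distinct robots do not cross. -/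
open Real

theorem gap_of_lt {n : ℕ} (θ : Fin n → ℝ) {k : ℕ} (h : k + 1 < n) :
    gap n θ ⟨k, by omega⟩ = θ ⟨k + 1, h⟩ - θ ⟨k, by omega⟩ := by
  simp [gap, h]

/-- In a biangular configuration, the even-indexed angles form an arithmetic progression. -/
theorem angle_two_mul_of_biangular {n : ℕ} {θ : Fin n → ℝ} {α β : ℝ}
    (hgap : ∀ i : Fin n, gap n θ i = if (i : ℕ) % 2 = 0 then α else β)
    (k : ℕ) (hk : 2 * k < n) :
    θ ⟨2 * k, hk⟩ = θ ⟨0, by omega⟩ + k * (α + β) := by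
  induction k with
  | zero => simp
  | succ k ih =>
    have h₀ := gap_of_lt θ (k := 2 * k) (by omega)
    have h₁ := gap_of_lt θ (k := 2 * k + 1) (by omega)
    rw [hgap, if_pos (by simp)] at h₀
    rw [hgap, if_neg (by simp only; omega)] at h₁
    have ih := ih (by omega)
    change θ ⟨2 * k + 1 + 1, _⟩ = _
    push_cast
    linarith

/-- The gaps of a biangular configuration of `2 * p` points sum to `2π`. -/
theorem mul_add_eq_two_pi_of_biangular {p : ℕ} (hp : 1 ≤ p) {θ : Fin (2 * p) → ℝ} {α β : ℝ}
    (hgap : ∀ i : Fin (2 * p), gap (2 * p) θ i = if (i : ℕ) % 2 = 0 then α else β) :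
    p * (α + β) = 2 * π := by
  obtain ⟨q, rfl⟩ := Nat.exists_eq_add_of_le' hp
  have h := angle_two_mul_of_biangular hgap q (by omega)
  have h₀ := gap_of_lt θ (k := 2 * q) (by omega)
  rw [hgap, if_pos (by simp)] at h₀
  have h₁ := hgap ⟨2 * q + 1, by omega⟩
  rw [if_neg (by simp only; omega), gap, dif_neg (by simp only; omega)] at h₁
  push_cast
  linarith

/-- An odd-indexed angle is followed by a gap of size `β`. -/
theorem add_le_angle_of_odd {n : ℕ} {θ : Fin n → ℝ} (hmono : StrictMono θ) {α β : ℝ}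
    (hgap : ∀ i : Fin n, gap n θ i = if (i : ℕ) % 2 = 0 then α else β)
    {i j : Fin n} (hij : i < j) (hi : (i : ℕ) % 2 ≠ 0) : θ i + β ≤ θ j := by
  have hij' : (i : ℕ) < j := hij
  have h := gap_of_lt θ (k := i) (by omega)
  rw [hgap, if_neg hi] at h
  have hle : θ ⟨i + 1, by omega⟩ ≤ θ j := hmono.monotone (Fin.mk_le_of_le_val hij')
  simp only [Fin.eta] at h
  linarith

/-- An even-indexed angle other than the first is preceded by a gap of size `β`. -/
theorem add_le_angle_of_even {n : ℕ} {θ : Fin n → ℝ} (hmono : StrictMono θ) {α β : ℝ}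
    (hgap : ∀ i : Fin n, gap n θ i = if (i : ℕ) % 2 = 0 then α else β)
    {i j : Fin n} (hij : i < j) (hj : (j : ℕ) % 2 = 0) : θ i + β ≤ θ j := by
  have hij' : (i : ℕ) < j := hij
  have hle : i ≤ ⟨j - 1, by omega⟩ := Fin.le_def.mpr (by simp only; omega)
  have h := add_le_angle_of_odd hmono hgap (i := ⟨j - 1, by omega⟩) (j := j)
    (Fin.lt_def.mpr (by simp only; omega)) (by simp only; omega)
  linarith [hmono.monotone hle]

/-- Trajectories of Procedure BQ do not cross: for a strict biangular circle of
`n = 2p` points with `0 < α < β` and `δ = π/n - α/2`, one has `δ ∈ (0, π/n)`, each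
robot moves by angular distance exactly `δ`, and the open angular intervals traversed
by the robots—`(θ i - δ, θ i)` for even `i` and `(θ i, θ i + δ)` for odd `i`—are
pairwise disjoint. -/
theorem BQ_trajectories_disjoint (n p : ℕ) (hp : 1 ≤ p) (hnp : n = 2 * p)
    (θ : Fin n → ℝ) (hmono : StrictMono θ)
    (α β : ℝ) (hα : 0 < α) (hαβ : α < β)
    (hgap : ∀ i : Fin n, gap n θ i = if (i : ℕ) % 2 = 0 then α else β)
    (δ : ℝ) (hδ : δ = π / n - α / 2)
    (θ' : Fin n → ℝ)
    (hθ' : ∀ i : Fin n, θ' i = if (i : ℕ) % 2 = 0 then θ i - δ else θ i + δ) :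
    0 < δ ∧ δ < π / n ∧
    (∀ i : Fin n, |θ' i - θ i| = δ) ∧
    (∀ i j : Fin n, i ≠ j →
      Disjoint
        (if (i : ℕ) % 2 = 0 then Set.Ioo (θ i - δ) (θ i) else Set.Ioo (θ i) (θ i + δ))
        (if (j : ℕ) % 2 = 0 then Set.Ioo (θ j - δ) (θ j) else Set.Ioo (θ j) (θ j + δ))) := by
  subst hnp
  have hsum := mul_add_eq_two_pi_of_biangular hp hgap
  have hp₀ : (0 : ℝ) < p := by exact_mod_cast hp
  have hπ : π / ((2 * p : ℕ) : ℝ) = (α + β) / 4 := by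
    push_cast
    field_simp
    linarith
  have hδβ : δ = (β - α) / 4 := by rw [hδ, hπ]; ring
  have hδ₀ : 0 < δ := by linarith
  refine ⟨hδ₀, by linarith, fun i => ?_, ?_⟩
  · rw [hθ']
    split_ifs
    · rw [sub_sub_cancel_left, abs_neg, abs_of_pos hδ₀]
    · rw [add_sub_cancel_left, abs_of_pos hδ₀]
  · intro i j hne
    wlog hij : i < j generalizing i j
    · exact (this j i hne.symm (lt_of_le_of_ne (not_lt.mp hij) hne.symm)).symm
    have hlt := hmono hij
    rw [Set.disjoint_left]
    intro x hxi hxj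
    by_cases hi : (i : ℕ) % 2 = 0 <;> by_cases hj : (j : ℕ) % 2 = 0 <;>
      simp only [hi, hj, if_true, if_false, Set.mem_Ioo] at hxi hxj
    · linarith [add_le_angle_of_even hmono hgap hij hj]
    · linarith
    · linarith [add_le_angle_of_odd hmono hgap hij hi]
    · linarith [add_le_angle_of_odd hmono hgap hij hi]
end

section
/- Let n = 2p with p ≥ 1 points form a strict biangular circle with 0 < α < β, and let δ = π/n − α/2 and θ' i = θ i − δ for even i, θ' i = θ i + δ for odd i be the Procedure BQ target angles. Then for every subset M ⊆ Fin n of activated robots: (i) the moved points {c + 2r·(cos(θ' i), sin(θ' i)) : i ∈ M} occupy |M| of the n vertices of the regular n-gon with vertex angles θ' 0 + k·(2π/n), k ∈ Fin n, inscribed in the circle of center c and radius 2r, i.e. they form a regular (|M|, n)-gon; and (ii) every non-activated robot j ∉ M satisfies |θ j − θ' j| = δ < π/n, so its angle lies strictly within the open arc of width 2π/n centered at its own vertex angle θ' j. -/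
open Real

/-- Angles whose central gaps alternate between `α` and `β` advance by `α + β` every two steps. -/
lemma angle_eq_of_gap_alternating {n : ℕ} (hn : 0 < n) {θ : Fin n → ℝ} {α β : ℝ}
    (hgap : ∀ i : Fin n, gap n θ i = if (i : ℕ) % 2 = 0 then α else β) (m : ℕ) (hm : m < n) :
    θ ⟨m, hm⟩ = θ ⟨0, hn⟩ + (m : ℝ) * ((α + β) / 2) +
      if m % 2 = 0 then 0 else (α - β) / 2 := by
  induction m with
  | zero => simp
  | succ m ih =>
    have ih := ih (by omega)
    have hg := hgap ⟨m, by omega⟩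
    simp only [gap, hm, dite_true] at hg
    push_cast
    rcases Nat.mod_two_eq_zero_or_one m with h | h
    · have h' : (m + 1) % 2 = 1 := by omega
      simp only [h, h', one_ne_zero, if_true, if_false] at hg ih ⊢
      linarith
    · have h' : (m + 1) % 2 = 0 := by omega
      simp only [h, h', one_ne_zero, if_true, if_false] at hg ih ⊢
      linarith

/-- In a strict biangular circle the two central angles add up to `4π/n`. -/
lemma add_eq_of_gap_alternating {n : ℕ} (hn : 0 < n) (heven : n % 2 = 0) {θ : Fin n → ℝ}
    {α β : ℝ} (hgap : ∀ i : Fin n, gap n θ i = if (i : ℕ) % 2 = 0 then α else β) :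
    α + β = 4 * (π / n) := by
  obtain ⟨k, rfl⟩ : ∃ k, n = k + 1 := ⟨n - 1, by omega⟩
  have hk : k % 2 = 1 := by omega
  have hangle := angle_eq_of_gap_alternating hn hgap k (by omega)
  have hg := hgap ⟨k, by omega⟩
  simp only [gap, lt_irrefl, dite_false, hk, one_ne_zero, if_false] at hg hangle
  have hk0 : ((k : ℝ) + 1) ≠ 0 := by positivity
  push_cast
  field_simp
  linarith

/-- Procedure BQ with an arbitrary activated subset `M`: for a strict biangular circle
of `n = 2p` points with `0 < α < β`, `δ = π/n - α/2`, and target angles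
`θ' i = θ i ∓ δ` (minus for even `i`, plus for odd `i`):
(i) the moved robots occupy `|M|` distinct vertices of the regular `n`-gon with vertex
angles `θ' 0 + k·(2π/n)`, `k ∈ Fin n` (a regular `(|M|, n)`-gon on the circle of
radius `2r`); and
(ii) every non-activated robot `j ∉ M` satisfies `|θ j - θ' j| = δ < π/n`, so its
angle lies strictly inside the open arc of width `2π/n` centered at its own vertex
angle `θ' j`. -/
theorem BQ_partial_activation (n p : ℕ) (hp : 1 ≤ p) (hnp : n = 2 * p)
    (θ : Fin n → ℝ) (hmono : StrictMono θ)
    (α β : ℝ) (hα : 0 < α) (hαβ : α < β)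
    (hgap : ∀ i : Fin n, gap n θ i = if (i : ℕ) % 2 = 0 then α else β)
    (δ : ℝ) (hδ : δ = π / n - α / 2)
    (θ' : Fin n → ℝ)
    (hθ' : ∀ i : Fin n, θ' i = if (i : ℕ) % 2 = 0 then θ i - δ else θ i + δ)
    (M : Set (Fin n)) :
    (∃ f : Fin n → Fin n, Set.InjOn f M ∧
      ∀ i ∈ M, θ' i = θ' ⟨0, by omega⟩ + (((f i : ℕ)) : ℝ) * (2 * π / n)) ∧
    δ < π / n ∧
    (∀ j : Fin n, j ∉ M →
      |θ j - θ' j| = δ ∧ θ j ∈ Set.Ioo (θ' j - π / n) (θ' j + π / n)) := by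
  have hn : 0 < n := by omega
  have hsum := add_eq_of_gap_alternating hn (by omega) hgap
  have hδ_pos : 0 < δ := by linarith
  have hδ_lt : δ < π / n := by linarith
  refine ⟨⟨id, Function.injective_id.injOn, fun i _ => ?_⟩, hδ_lt, fun j _ => ?_⟩
  · have hangle := angle_eq_of_gap_alternating hn hgap i i.isLt
    have hmul : (i : ℝ) * ((α + β) / 2) = i * (2 * π / n) := by
      rw [hsum]
      ring
    rw [hmul] at hangle
    rw [hθ' i, hθ' ⟨0, _⟩]
    simp only [id, Nat.zero_mod, if_true]
    split_ifs at hangle ⊢ <;> linarith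
  · have habs : |θ j - θ' j| = δ := by
      rw [hθ' j]
      split_ifs
      · rw [sub_sub_cancel, abs_of_pos hδ_pos]
      · rw [sub_add_cancel_left, abs_neg, abs_of_pos hδ_pos]
    obtain ⟨hl, hr⟩ := abs_lt.mp (habs.trans_lt hδ_lt)
    exact ⟨habs, by linarith, by linarith⟩
end

section
/- Let n = 2p with p ≥ 2 and let C be a circle of the plane. For every similarity-equivariant deterministic oblivious algorithm A there exist a strict biangular initial configuration x₀ of n points on C and a fair schedule such that, in the resulting execution, it is not the case that all robots remain on C at all times and the positions form a regular n-gon at some time; i.e., no similarity-equivariant deterministic oblivious algorithm solves UTP in finite time starting from a strict biangular circle. -/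
open Real

/-- A similarity of the plane (identified with `ℂ`): `f x = s • L x + v` with `s > 0`
and `L` a linear isometry. -/
def IsSimilarity (f : ℂ → ℂ) : Prop :=
  ∃ (s : ℝ) (L : ℂ ≃ₗᵢ[ℝ] ℂ) (v : ℂ), 0 < s ∧ ∀ x, f x = s • L x + v

/-- A deterministic oblivious algorithm is similarity-equivariant if it commutes with
every similarity of the plane. -/
def Equivariant (A : ℂ → Multiset ℂ → ℂ) : Prop :=
  ∀ f : ℂ → ℂ, IsSimilarity f → ∀ (x : ℂ) (m : Multiset ℂ),
    A (f x) (Multiset.map f m) = f (A x m)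

open scoped Classical

/-- The execution of algorithm `A` from initial configuration `x₀` under schedule `S`:
at each step, exactly the robots in `S t` apply `A` to their own position and the
multiset of all current positions; the others stay put. -/
noncomputable def exec (n : ℕ) (A : ℂ → Multiset ℂ → ℂ) (x₀ : Fin n → ℂ)
    (S : ℕ → Set (Fin n)) : ℕ → Fin n → ℂ
  | 0 => x₀
  | t + 1 => fun i =>
      if i ∈ S t then
        A (exec n A x₀ S t i) (Multiset.map (exec n A x₀ S t) Finset.univ.val)
      else exec n A x₀ S t i

/-- A fair schedule: every step activates a nonempty set of robots, and every robot is
activated infinitely often. -/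
def FairSchedule (n : ℕ) (S : ℕ → Set (Fin n)) : Prop :=
  (∀ t, (S t).Nonempty) ∧ ∀ (i : Fin n) (T : ℕ), ∃ t, T ≤ t ∧ i ∈ S t

/-- The positions form a regular `n`-gon on the circle of center `c` and radius `ρ`:
up to a permutation, they are the points of angles `φ + 2πk/n`, `k ∈ Fin n`. -/
def FormsRegularNgon (n : ℕ) (c : ℂ) (ρ : ℝ) (pos : Fin n → ℂ) : Prop :=
  ∃ (φ : ℝ) (σ : Equiv.Perm (Fin n)), ∀ i : Fin n,
    pos (σ i) = c + (ρ : ℂ) * Complex.exp (((φ + 2 * π * ((i : ℕ) : ℝ) / n : ℝ) : ℂ) * Complex.I)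

/-- `A` solves the Uniform Transformation Problem on the circle of center `c` and
radius `ρ` in finite time: from every configuration of `n` distinct points of the
circle and under every fair schedule, all robots stay on the circle forever and at
some time the positions form a regular `n`-gon. -/
def SolvesUTP (n : ℕ) (c : ℂ) (ρ : ℝ) (A : ℂ → Multiset ℂ → ℂ) : Prop :=
  ∀ x₀ : Fin n → ℂ, Function.Injective x₀ → (∀ i, x₀ i ∈ Metric.sphere c ρ) →
    ∀ S : ℕ → Set (Fin n), FairSchedule n S →
      (∀ t i, exec n A x₀ S t i ∈ Metric.sphere c ρ) ∧
      ∃ t, FormsRegularNgon n c ρ (exec n A x₀ S t)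

/-- A strict biangular configuration on the circle of center `c` and radius `ρ`:
`n` points of the circle whose consecutive central gaps, in cyclic angular order,
alternate between two positive values `α ≠ β`. -/
def IsStrictBiangularOn (n : ℕ) (c : ℂ) (ρ : ℝ) (P : Multiset ℂ) : Prop :=
  ∃ (θ : Fin n → ℝ) (α β : ℝ), α ≠ β ∧ 0 < α ∧ 0 < β ∧ StrictMono θ ∧
    (∀ i : Fin n, gap n θ i = if (i : ℕ) % 2 = 0 then α else β) ∧
    P = Multiset.map (fun i => c + (ρ : ℂ) * Complex.exp (((θ i : ℝ) : ℂ) * Complex.I))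
          Finset.univ.val

/-- The configuration reached from `x` when exactly the robots of `T` move. -/
noncomputable def move {n : ℕ} (A : ℂ → Multiset ℂ → ℂ) (x : Fin n → ℂ) (T : Set (Fin n)) :
    Fin n → ℂ :=
  fun i => if i ∈ T then A (x i) (Multiset.map x Finset.univ.val) else x i

/-- If from every configuration satisfying `I` the adversary can activate a set containing `K t`
so that `I` survives whenever the robots stay in `Q`, then there is a schedule containing `K`
along which `I` holds forever whenever the robots stay in `Q` forever. -/
lemma exists_schedule_preserving {n : ℕ} (A : ℂ → Multiset ℂ → ℂ) (x₀ : Fin n → ℂ)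
    (I : (Fin n → ℂ) → Prop) (Q : Set ℂ) (K : ℕ → Set (Fin n)) (h₀ : I x₀)
    (h : ∀ t x, I x → ∃ T, K t ⊆ T ∧ ((∀ i, move A x T i ∈ Q) → I (move A x T))) :
    ∃ S : ℕ → Set (Fin n), (∀ t, K t ⊆ S t) ∧
      ((∀ t i, exec n A x₀ S t i ∈ Q) → ∀ t, I (exec n A x₀ S t)) := by
  have h' : ∀ t x, ∃ T, K t ⊆ T ∧ (I x → (∀ i, move A x T i ∈ Q) → I (move A x T)) := by
    intro t x
    by_cases hx : I x
    · obtain ⟨T, hT, hT'⟩ := h t x hx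
      exact ⟨T, hT, fun _ => hT'⟩
    · exact ⟨K t, subset_rfl, fun hx' => absurd hx' hx⟩
  choose T hKT hT using h'
  let y : ℕ → Fin n → ℂ := fun t => Nat.rec x₀ (fun t x => move A x (T t x)) t
  have hy : ∀ t, exec n A x₀ (fun t => T t (y t)) t = y t := by
    intro t
    induction t with
    | zero => rfl
    | succ t ih =>
      funext i
      simp only [exec, ih]
      rfl
  refine ⟨fun t => T t (y t), fun t => hKT t _, fun hQ t => ?_⟩
  induction t with
  | zero => exact h₀
  | succ t ih =>
    rw [hy] at ih ⊢
    refine hT t (y t) ih fun i => ?_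
    have := hQ (t + 1) i
    rwa [hy] at this

lemma isSimilarity_rotation (c : ℂ) (a : Circle) : IsSimilarity fun x => c + a * (x - c) :=
  ⟨1, rotation a, c - a * c, one_pos, fun x => by simp only [rotation_apply, one_smul]; ring⟩

lemma isSimilarity_reflection (c : ℂ) (a : Circle) :
    IsSimilarity fun x => c + a * (starRingEnd ℂ) (x - c) :=
  ⟨1, Complex.conjLIE.trans (rotation a), c - a * (starRingEnd ℂ) c, one_pos, fun x => by
    simp only [LinearIsometryEquiv.trans_apply, rotation_apply, Complex.conjLIE_apply, one_smul,
      map_sub]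
    ring⟩

/-- Two regular `p`-gons on the unit circle, with base vertices `z` and `z * w`. -/
noncomputable def twoPolygons (p : ℕ) [NeZero p] (z w : Circle) (l : ZMod p × Bool) : Circle :=
  z * ZMod.toCircle l.1 * (if l.2 then w else 1)

/-- The point of the circle of center `c` and radius `ρ` with direction `a`. -/
def onCircle (c : ℂ) (ρ : ℝ) (a : Circle) : ℂ := c + ρ * (a : ℂ)

lemma exists_onCircle_of_mem_sphere {c : ℂ} {ρ : ℝ} (hρ : 0 < ρ) {x : ℂ}
    (hx : x ∈ Metric.sphere c ρ) : ∃ a : Circle, x = onCircle c ρ a := by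
  have hρ' : (ρ : ℂ) ≠ 0 := by exact_mod_cast hρ.ne'
  refine ⟨⟨(x - c) / ρ, ?_⟩, ?_⟩
  · rw [mem_sphere_iff_norm] at hx
    simp [Submonoid.unitSphere, hx, abs_of_pos hρ, hρ.ne']
  · simp only [onCircle]
    field_simp
    ring

/-- Equivariance along a symmetry of a configuration. -/
lemma Equivariant.apply_of_symm {n : ℕ} {A : ℂ → Multiset ℂ → ℂ} (hA : Equivariant A)
    {f : ℂ → ℂ} (hf : IsSimilarity f) {x : Fin n → ℂ} {σ : Equiv.Perm (Fin n)}
    (hσ : ∀ i, f (x i) = x (σ i)) (i : Fin n) :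
    A (x (σ i)) (Multiset.map x Finset.univ.val) =
      f (A (x i) (Multiset.map x Finset.univ.val)) := by
  rw [← hA f hf, Multiset.map_map, ← hσ]
  congr 1
  have : f ∘ x = x ∘ σ := funext hσ
  rw [this, ← Multiset.map_map, Multiset.map_univ_val_equiv]

section

variable {p n : ℕ} [NeZero p] (e : Fin n ≃ ZMod p × Bool) {c : ℂ} {ρ : ℝ}

/-- If the base robot of a pair of regular polygons rotates by `u`, then the robots of its polygon
rotate by `u` and the robots of the other one by `u⁻¹`. -/
lemma Equivariant.destination_twoPolygons {A : ℂ → Multiset ℂ → ℂ} (hA : Equivariant A)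
    {x : Fin n → ℂ} {z w u : Circle} (hx : ∀ i, x i = onCircle c ρ (twoPolygons p z w (e i)))
    (hu : A (x (e.symm (0, false))) (Multiset.map x Finset.univ.val) = onCircle c ρ (z * u))
    (i : Fin n) :
    A (x i) (Multiset.map x Finset.univ.val) =
      onCircle c ρ (twoPolygons p z w (e i) * if (e i).2 then u⁻¹ else u) := by
  obtain ⟨⟨k, b⟩, rfl⟩ := e.symm.surjective i
  cases b
  · have key := hA.apply_of_symm (isSimilarity_rotation c (ZMod.toCircle k)) (x := x)
      (σ := e.trans (((Equiv.addLeft k).prodCongr (Equiv.refl Bool)).trans e.symm)) (fun i => by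
        simp only [hx, onCircle, twoPolygons, Equiv.trans_apply, Equiv.apply_symm_apply,
          Equiv.prodCongr_apply, Prod.map, Equiv.coe_addLeft, Equiv.refl_apply,
          AddChar.map_add_eq_mul, Circle.coe_mul]
        ring) (e.symm (0, false))
    rw [hu] at key
    simp only [Equiv.trans_apply, Equiv.apply_symm_apply, Equiv.prodCongr_apply, Prod.map,
      Equiv.coe_addLeft, Equiv.refl_apply, add_zero] at key
    rw [key]
    simp [onCircle, twoPolygons]
    ring
  · have key := hA.apply_of_symm (isSimilarity_reflection c (z ^ 2 * w * ZMod.toCircle k)) (x := x)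
      (σ := e.trans (((Equiv.subLeft k).prodCongr Equiv.boolNot).trans e.symm)) (fun i => by
        simp only [hx, onCircle, Equiv.trans_apply, Equiv.apply_symm_apply,
          Equiv.prodCongr_apply, Prod.map, Equiv.subLeft_apply, Equiv.boolNot_apply,
          add_sub_cancel_left, map_mul, Complex.conj_ofReal, ← Circle.coe_inv_eq_conj]
        rw [mul_left_comm, ← Circle.coe_mul]
        congr 3
        rcases e i with ⟨l, b⟩
        apply Circle.ext
        cases b <;> simp [twoPolygons, AddChar.map_sub_eq_div] <;> field_simp)
        (e.symm (0, false))
    rw [hu] at key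
    simp only [Equiv.trans_apply, Equiv.apply_symm_apply, Equiv.prodCongr_apply, Prod.map,
      Equiv.subLeft_apply, Equiv.boolNot_apply, sub_zero, Bool.not_false] at key
    rw [key]
    simp only [onCircle, add_sub_cancel_left, map_mul, Complex.conj_ofReal,
      ← Circle.coe_inv_eq_conj, Equiv.apply_symm_apply]
    rw [mul_left_comm, ← Circle.coe_mul]
    congr 2
    simp [twoPolygons]
    field_simp

/-- The robots form two regular `p`-gons whose union is not a regular `2p`-gon. -/
def IsNonregularPair (c : ℂ) (ρ : ℝ) (x : Fin n → ℂ) : Prop :=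
  ∃ z w : Circle, (w : ℂ) ^ p ≠ -1 ∧ ∀ i, x i = onCircle c ρ (twoPolygons p z w (e i))

/-- The adversary can activate all robots, or else either of the two polygons, so that
the configuration remains a nonregular pair. -/
lemma IsNonregularPair.exists_activation (hρ : 0 < ρ) {A : ℂ → Multiset ℂ → ℂ}
    (hA : Equivariant A) {x : Fin n → ℂ} (hx : IsNonregularPair e c ρ x) (b : Bool) :
    ∃ T : Set (Fin n), {i | (e i).2 = b} ⊆ T ∧
      ((∀ i, move A x T i ∈ Metric.sphere c ρ) → IsNonregularPair e c ρ (move A x T)) := by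
  obtain ⟨z, w, hw, hx⟩ := hx
  by_cases hs : A (x (e.symm (0, false))) (Multiset.map x Finset.univ.val) ∈ Metric.sphere c ρ
  swap
  · refine ⟨Set.univ, Set.subset_univ _, fun h => absurd ?_ hs⟩
    simpa [move] using h (e.symm (0, false))
  obtain ⟨a, ha⟩ := exists_onCircle_of_mem_sphere hρ hs
  obtain ⟨u, rfl⟩ : ∃ u, a = z * u := ⟨z⁻¹ * a, by simp⟩
  have hd := hA.destination_twoPolygons e hx ha
  by_cases hall : ((w * u⁻¹ * u⁻¹ : Circle) : ℂ) ^ p = -1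
  · have hw' : ((w * u⁻¹ : Circle) : ℂ) ^ p ≠ -1 := by
      intro hhalf
      rw [Circle.coe_mul, mul_pow, hhalf] at hall
      rw [Circle.coe_mul, mul_pow] at hhalf
      have h1 : ((u⁻¹ : Circle) : ℂ) ^ p = 1 := by linear_combination -hall
      rw [h1, mul_one] at hhalf
      exact hw hhalf
    refine ⟨{i | (e i).2 = b}, subset_rfl, fun _ => ?_⟩
    refine ⟨if b then z else z * u, w * u⁻¹, hw', fun i => ?_⟩
    simp only [move, Set.mem_ofPred_eq, hd]
    rw [hx, ← apply_ite (onCircle c ρ)]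
    congr 1
    apply Circle.ext
    rcases e i with ⟨k, b'⟩
    cases b <;> cases b' <;> simp [twoPolygons] <;> field_simp
  · refine ⟨Set.univ, Set.subset_univ _, fun _ => ⟨z * u, _, hall, fun i => ?_⟩⟩
    simp only [move, Set.mem_univ, if_true, hd]
    congr 1
    apply Circle.ext
    rcases e i with ⟨k, b'⟩
    cases b' <;> simp [twoPolygons] <;> field_simp

lemma twoPolygons_pow (z w : Circle) (l : ZMod p × Bool) :
    twoPolygons p z w l ^ p = z ^ p * (if l.2 then w ^ p else 1) := by
  have h : ZMod.toCircle l.1 ^ p = 1 := by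
    rw [← AddChar.map_nsmul_eq_pow]
    simp
  rw [twoPolygons, mul_pow, mul_pow, h, mul_one, ite_pow, one_pow]

lemma IsNonregularPair.not_formsRegularNgon (hρ : 0 < ρ) (hn : n = 2 * p) {x : Fin n → ℂ}
    (hx : IsNonregularPair e c ρ x) : ¬ FormsRegularNgon n c ρ x := by
  rintro ⟨φ, σ, hreg⟩
  obtain ⟨z, w, hw, hx⟩ := hx
  have hρ' : (ρ : ℂ) ≠ 0 := by exact_mod_cast hρ.ne'
  have hp : (p : ℂ) ≠ 0 := by exact_mod_cast NeZero.ne p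
  have hp0 : 0 < p := Nat.pos_of_ne_zero (NeZero.ne p)
  have key : ∀ i, (z : ℂ) ^ p * (if (e (σ i)).2 then (w : ℂ) ^ p else 1) =
      Complex.exp (p * φ * Complex.I) * (-1) ^ (i : ℕ) := by
    intro i
    have h := hreg i
    rw [hx, onCircle, add_right_inj, mul_right_inj' hρ'] at h
    have h2 := congrArg (fun y : Circle => (y : ℂ)) (twoPolygons_pow z w (e (σ i)))
    simp only [Circle.coe_pow, Circle.coe_mul, h] at h2
    rw [apply_ite (fun y : Circle => (y : ℂ))] at h2
    simp only [Circle.coe_pow, Circle.coe_one] at h2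
    rw [← h2, ← Complex.exp_pi_mul_I, ← Complex.exp_nat_mul, ← Complex.exp_nat_mul,
      ← Complex.exp_add]
    congr 1
    subst hn
    push_cast
    field_simp
  have h0 := key ⟨0, by omega⟩
  have h1 := key ⟨1, by omega⟩
  have hE := Complex.exp_ne_zero (p * φ * Complex.I)
  have hz : (z : ℂ) ^ p ≠ 0 := pow_ne_zero _ (Circle.coe_ne_zero z)
  simp only [pow_zero, pow_one, mul_one] at h0 h1
  have hsum := congrArg₂ (· + ·) h0 h1
  simp only [mul_neg, mul_one, add_neg_cancel, ← mul_add, mul_eq_zero, hz, false_or] at hsum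
  rw [← h0] at hE
  split_ifs at hsum hE
  · rw [← two_mul] at hsum
    simp [NeZero.ne p] at hsum
  · exact hw (by linear_combination hsum)
  · exact hw (by linear_combination hsum)
  · norm_num at hsum

end

/-- The labelling of `2p` robots by position in their polygon and polygon. -/
noncomputable def polygonLabel (p : ℕ) [NeZero p] : Fin (2 * p) ≃ ZMod p × Bool :=
  Equiv.ofBijective (fun i => (((i : ℕ) / 2 : ℕ), decide ((i : ℕ) % 2 = 1))) <| by
    rw [Fintype.bijective_iff_injective_and_card]
    refine ⟨fun i j h => ?_, by simp [ZMod.card, mul_comm]⟩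
    obtain ⟨h1, h2⟩ := Prod.ext_iff.1 h
    simp only [ZMod.natCast_eq_natCast_iff', decide_eq_decide] at h1 h2
    rw [Nat.mod_eq_of_lt (by omega), Nat.mod_eq_of_lt (by omega)] at h1
    ext
    omega

/-- The two regular polygons at angle `2π/(3p)` are strictly biangular. -/
lemma isStrictBiangularOn_twoPolygons (p : ℕ) [NeZero p] (c : ℂ) (ρ : ℝ) :
    IsStrictBiangularOn (2 * p) c ρ (Multiset.map (fun i => onCircle c ρ
      (twoPolygons p 1 (Circle.exp (2 * π / (3 * p))) (polygonLabel p i))) Finset.univ.val) := by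
  have hp0 : 0 < p := Nat.pos_of_ne_zero (NeZero.ne p)
  have hp : (0 : ℝ) < p := by exact_mod_cast hp0
  have hα : 0 < 2 * π / (3 * p) := by positivity
  have hsum : 2 * π / p = 3 * (2 * π / (3 * p)) := by field_simp
  have hcirc : 2 * π = 3 * p * (2 * π / (3 * p)) := by field_simp
  set α := 2 * π / (3 * p)
  refine ⟨fun i => (3 * ((i : ℕ) / 2 : ℕ) + ((i : ℕ) % 2 : ℕ)) * α, α, 2 * α, by linarith, hα,
    by linarith, ?_, ?_, ?_⟩
  · intro i j hij
    refine mul_lt_mul_of_pos_right ?_ hα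
    have : (i : ℕ) < j := hij
    exact_mod_cast (by omega : 3 * ((i : ℕ) / 2) + (i : ℕ) % 2 < 3 * ((j : ℕ) / 2) + (j : ℕ) % 2)
  · rintro ⟨i, hi⟩
    rcases Nat.even_or_odd' i with ⟨k, rfl | rfl⟩
    · have h1 : (2 * k + 1) / 2 = k := by omega
      have h2 : 2 * k + 1 < 2 * p := by omega
      simp only [gap, h1, h2, dif_pos]
      norm_num [Nat.add_mod]
      ring
    · have h1 : (2 * k + 1) / 2 = k := by omega
      have h2 : (2 * k + 1 + 1) / 2 = k + 1 := by omega
      have h3 : (2 * k + 1) % 2 = 1 := by omega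
      have h4 : (2 * k + 1 + 1) % 2 = 0 := by omega
      by_cases h : 2 * k + 1 + 1 < 2 * p
      · simp only [gap, h, dif_pos, h1, h2, h3, h4]
        push_cast
        norm_num
        ring
      · have hk : p = k + 1 := by omega
        simp only [gap, h, dif_neg, not_false_eq_true, h1, h3]
        rw [hcirc, hk]
        push_cast
        norm_num
        ring
  · congr 1
    funext i
    simp only [onCircle]
    congr 2
    simp only [twoPolygons, polygonLabel, Equiv.ofBijective_apply, one_mul, Circle.coe_mul,
      ZMod.toCircle_natCast, decide_eq_true_eq]
    rw [add_mul, Complex.ofReal_add, add_mul, Complex.exp_add]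
    congr 1
    · congr 1
      rw [mul_right_comm (3 : ℝ), ← hsum]
      push_cast
      ring
    · rcases Nat.mod_two_eq_zero_or_one i with h | h <;> simp [h, Circle.coe_exp]

lemma isNonregularPair_initial (p : ℕ) [NeZero p] (c : ℂ) (ρ : ℝ) :
    IsNonregularPair (polygonLabel p) c ρ fun i => onCircle c ρ
      (twoPolygons p 1 (Circle.exp (2 * π / (3 * p))) (polygonLabel p i)) := by
  refine ⟨1, _, fun h => ?_, fun i => rfl⟩
  have hp : (p : ℂ) ≠ 0 := by exact_mod_cast NeZero.ne p
  have h3 : (Circle.exp (2 * π / (3 * p)) : ℂ) ^ (p * 3) = 1 := by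
    rw [Circle.coe_exp, ← Complex.exp_nat_mul, ← Complex.exp_two_pi_mul_I]
    congr 1
    push_cast
    field_simp
  rw [pow_mul, h] at h3
  norm_num at h3

/-- For every similarity-equivariant deterministic oblivious algorithm `A` there exist
a strict biangular initial configuration of `n = 2p` points on the circle and a fair
schedule under which `A` fails: it is not the case that all robots remain on the
circle at all times and that the positions form a regular `n`-gon at some time. -/
theorem UTP_fails_from_strict_biangular (p n : ℕ) (hp : 2 ≤ p) (hnp : n = 2 * p)
    (c : ℂ) (ρ : ℝ) (hρ : 0 < ρ)
    (A : ℂ → Multiset ℂ → ℂ) (hA : Equivariant A) :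
    ∃ (x₀ : Fin n → ℂ) (S : ℕ → Set (Fin n)),
      IsStrictBiangularOn n c ρ (Multiset.map x₀ Finset.univ.val) ∧
      FairSchedule n S ∧
      ¬ ((∀ t i, exec n A x₀ S t i ∈ Metric.sphere c ρ) ∧
          ∃ t, FormsRegularNgon n c ρ (exec n A x₀ S t)) := by
  subst hnp
  have : NeZero p := ⟨by omega⟩
  let e := polygonLabel p
  obtain ⟨S, hKS, hS⟩ := exists_schedule_preserving A _ (IsNonregularPair e c ρ)
    (Metric.sphere c ρ) (fun t => {i | (e i).2 = decide (t % 2 = 1)})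
    (isNonregularPair_initial p c ρ) (fun t x hx => hx.exists_activation e hρ hA _)
  refine ⟨_, S, isStrictBiangularOn_twoPolygons p c ρ, ⟨fun t => ?_, fun i T => ?_⟩, ?_⟩
  · exact ⟨e.symm (0, decide (t % 2 = 1)), hKS t (by simp)⟩
  · refine ⟨2 * T + if (e i).2 then 1 else 0, by omega, hKS _ ?_⟩
    cases h : (e i).2 <;> simp [h, Nat.add_mod]
  · rintro ⟨hsphere, t, ht⟩
    exact (hS hsphere t).not_formsRegularNgon e hρ rfl ht
end
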